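/- Assume Σ_{d=1}^n r_d² = 1, r_d > 0 for all d, that f_1, …, f_n span ℝ^m and generate a discrete additive subgroup of ℝ^m, and that e_1, …, e_n span ℝ^l. Let Ĥ : ℝ^l × ℝ^m → ℍ^n be the mean curvature field of the torus in the unit sphere, Ĥ_d(x,y) = (1 − α_d/(l+m)) ψ_d(x,y). Then for every (x,y) the vector Ĥ(x,y)·k (componentwise right multiplication by k) lies in the real span of the partial derivatives of ψ at (x,y) if and only if rk_ℤ⟨f''_1, …, f''_n⟩ = m, where f''_d := (f_d; α_d − (l+m)) ∈ ℝ^{m+1}. -/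

import Mathlib

open scoped Quaternion
open Matrix

noncomputable section

/-- `exp(t·j) = cos t + (sin t)·j` -/
def expJ (t : ℝ) : ℍ[ℝ] := ⟨Real.cos t, 0, Real.sin t, 0⟩
/-- `exp(t·k) = cos t + (sin t)·k` -/
def expK (t : ℝ) : ℍ[ℝ] := ⟨Real.cos t, 0, 0, Real.sin t⟩
def qi : ℍ[ℝ] := ⟨0, 1, 0, 0⟩
def qj : ℍ[ℝ] := ⟨0, 0, 1, 0⟩
def qk : ℍ[ℝ] := ⟨0, 0, 0, 1⟩

variable {n l m : ℕ}

/-- the torus map ψ -/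
def psi (r : Fin n → ℝ) (e : Fin n → Fin l → ℝ) (f : Fin n → Fin m → ℝ)
    (x : Fin l → ℝ) (y : Fin m → ℝ) (d : Fin n) : ℍ[ℝ] :=
  ((r d : ℝ) : ℍ[ℝ]) * expJ (∑ i, e d i * x i) * expK (∑ i, f d i * y i)

/-- ∂ψ/∂x_p -/
def dpsiX (r : Fin n → ℝ) (e : Fin n → Fin l → ℝ) (f : Fin n → Fin m → ℝ)
    (x : Fin l → ℝ) (y : Fin m → ℝ) (p : Fin l) (d : Fin n) : ℍ[ℝ] :=
  ((r d * e d p : ℝ) : ℍ[ℝ]) * (qj * expJ (∑ i, e d i * x i) * expK (∑ i, f d i * y i))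

/-- ∂ψ/∂y_q -/
def dpsiY (r : Fin n → ℝ) (e : Fin n → Fin l → ℝ) (f : Fin n → Fin m → ℝ)
    (x : Fin l → ℝ) (y : Fin m → ℝ) (q : Fin m) (d : Fin n) : ℍ[ℝ] :=
  ((r d * f d q : ℝ) : ℍ[ℝ]) * (expJ (∑ i, e d i * x i) * (qk * expK (∑ i, f d i * y i)))

/-- the tangent space of the torus at the point ψ(x,y): the real span of the partials -/
def tangentSpan (r : Fin n → ℝ) (e : Fin n → Fin l → ℝ) (f : Fin n → Fin m → ℝ)
    (x : Fin l → ℝ) (y : Fin m → ℝ) : Submodule ℝ (Fin n → ℍ[ℝ]) :=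
  Submodule.span ℝ (Set.range (Sum.elim (dpsiX r e f x y) (dpsiY r e f x y)))

/-- the block G₁ of the induced metric -/
def G1 (r : Fin n → ℝ) (e : Fin n → Fin l → ℝ) : Matrix (Fin l) (Fin l) ℝ :=
  ∑ d, (r d) ^ 2 • Matrix.vecMulVec (e d) (e d)

/-- the block G₂ of the induced metric -/
def G2 (r : Fin n → ℝ) (f : Fin n → Fin m → ℝ) : Matrix (Fin m) (Fin m) ℝ :=
  ∑ d, (r d) ^ 2 • Matrix.vecMulVec (f d) (f d)

/-- α_d = ⟨G₁⁻¹ e_d, e_d⟩ + ⟨G₂⁻¹ f_d, f_d⟩ -/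
def alpha (r : Fin n → ℝ) (e : Fin n → Fin l → ℝ) (f : Fin n → Fin m → ℝ) (d : Fin n) : ℝ :=
  (G1 r e)⁻¹ *ᵥ e d ⬝ᵥ e d + (G2 r f)⁻¹ *ᵥ f d ⬝ᵥ f d

/-- ∂²ψ/∂x_p∂x_q -/
def d2psiXX (r : Fin n → ℝ) (e : Fin n → Fin l → ℝ) (f : Fin n → Fin m → ℝ)
    (x : Fin l → ℝ) (y : Fin m → ℝ) (p q : Fin l) (d : Fin n) : ℍ[ℝ] :=
  ((r d * (e d p * e d q) : ℝ) : ℍ[ℝ]) *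
    (qj * qj * expJ (∑ i, e d i * x i) * expK (∑ i, f d i * y i))

/-- ∂²ψ/∂y_r∂y_s -/
def d2psiYY (r : Fin n → ℝ) (e : Fin n → Fin l → ℝ) (f : Fin n → Fin m → ℝ)
    (x : Fin l → ℝ) (y : Fin m → ℝ) (p q : Fin m) (d : Fin n) : ℍ[ℝ] :=
  ((r d * (f d p * f d q) : ℝ) : ℍ[ℝ]) *
    (expJ (∑ i, e d i * x i) * (qk * qk * expK (∑ i, f d i * y i)))

/-- the Laplace–Beltrami operator of the flat torus applied to ψ -/
def lap (r : Fin n → ℝ) (e : Fin n → Fin l → ℝ) (f : Fin n → Fin m → ℝ)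
    (x : Fin l → ℝ) (y : Fin m → ℝ) (d : Fin n) : ℍ[ℝ] :=
  (∑ p, ∑ q, (G1 r e)⁻¹ p q • d2psiXX r e f x y p q d) +
  (∑ p, ∑ q, (G2 r f)⁻¹ p q • d2psiYY r e f x y p q d)

/-- rk_ℤ⟨v_1, …, v_n⟩ : rank of the additive subgroup generated by the `v d` -/
def zrank {k : ℕ} (v : Fin n → (Fin k → ℝ)) : ℕ :=
  Module.finrank ℤ (Submodule.span ℤ (Set.range v))


/-- The vectors obtained by appending `g d` to `f d`, for `f` generating a lattice, generate a group
of the same rank as the lattice iff `g` is the restriction of a linear functional. -/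
lemma zrank_snoc_eq_iff (f : Fin n → Fin m → ℝ) (g : Fin n → ℝ)
    (hspan : Submodule.span ℝ (Set.range f) = ⊤)
    (hdisc : DiscreteTopology ↥(AddSubgroup.closure (Set.range f))) :
    zrank (k := m + 1) (fun d => Fin.snoc (f d) (g d)) = m ↔ ∃ b, ∀ d, g d = f d ⬝ᵥ b := by
  have hL : DiscreteTopology ↥(Submodule.span ℤ (Set.range f)) := by
    have h := Submodule.span_int_eq_addSubgroupClosure (Set.range f)
    rw [← h] at hdisc
    exact hdisc
  have hZ : IsZLattice ℝ (Submodule.span ℤ (Set.range f)) :=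
    ⟨by rw [Submodule.span_span_of_tower]; exact hspan⟩
  have hrank := ZLattice.rank ℝ (Submodule.span ℤ (Set.range f))
  rw [Module.finrank_fin_fun] at hrank
  unfold zrank
  constructor
  · intro h
    set F : Submodule ℤ (Fin (m + 1) → ℝ) :=
      Submodule.span ℤ (Set.range fun d => (Fin.snoc (f d) (g d) : Fin (m + 1) → ℝ)) with hF
    have hfinite : Module.Finite ℤ F := Module.Finite.span_of_finite ℤ (Set.finite_range _)
    have hfin : ∀ d, (Fin.snoc (f d) (g d) : Fin (m + 1) → ℝ) ∈ F :=
      fun d => Submodule.subset_span ⟨d, rfl⟩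
    let p : (Fin (m + 1) → ℝ) →ₗ[ℤ] (Fin m → ℝ) := LinearMap.funLeft ℤ ℝ Fin.castSucc
    have hp : ∀ d, p (Fin.snoc (f d) (g d)) = f d := fun d => by
      ext i; simp [p, LinearMap.funLeft_apply]
    have hmap : (p ∘ₗ F.subtype).range = Submodule.span ℤ (Set.range f) := by
      rw [LinearMap.range_comp, Submodule.range_subtype, hF, Submodule.map_span, ← Set.range_comp]
      congr 2
      funext d
      exact hp d
    have hker : (p ∘ₗ F.subtype).ker = ⊥ := by
      have h1 := Submodule.finrank_quotient_add_finrank (p ∘ₗ F.subtype).ker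
      rw [(p ∘ₗ F.subtype).quotKerEquivRange.finrank_eq, hmap, hrank, h] at h1
      exact Submodule.finrank_eq_zero.mp (by omega)
    let σ := (LinearEquiv.ofInjective _ (LinearMap.ker_eq_bot.mp hker)).trans
      (LinearEquiv.ofEq _ _ hmap)
    let c : Submodule.span ℤ (Set.range f) →ₗ[ℤ] ℝ :=
      LinearMap.proj (R := ℤ) (φ := fun _ : Fin (m + 1) => ℝ) (Fin.last m) ∘ₗ F.subtype ∘ₗ
        σ.symm.toLinearMap
    have hc : ∀ d, c ⟨f d, Submodule.subset_span ⟨d, rfl⟩⟩ = g d := fun d => by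
      have : σ.symm ⟨f d, Submodule.subset_span ⟨d, rfl⟩⟩ = ⟨_, hfin d⟩ := by
        rw [LinearEquiv.symm_apply_eq]
        exact Subtype.ext (hp d).symm
      simp [c, this]
    have : Module.Finite ℤ (Submodule.span ℤ (Set.range f)) :=
      Module.Finite.span_of_finite ℤ (Set.finite_range _)
    have : Module.Free ℤ (Submodule.span ℤ (Set.range f)) := ZLattice.module_free ℝ _
    let B := Module.Free.chooseBasis ℤ (Submodule.span ℤ (Set.range f))
    let φ : (Fin m → ℝ) →ₗ[ℝ] ℝ := (B.ofZLatticeBasis ℝ _).constr ℝ fun i => c (B i)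
    have hφ : φ.restrictScalars ℤ ∘ₗ (Submodule.span ℤ (Set.range f)).subtype = c := by
      refine B.ext fun i => ?_
      have := (B.ofZLatticeBasis ℝ _).constr_basis ℝ (fun i => c (B i)) i
      rwa [Module.Basis.ofZLatticeBasis_apply] at this
    refine ⟨fun i => φ (Pi.single i 1), fun d => ?_⟩
    rw [← hc d, ← hφ]
    simp only [LinearMap.comp_apply, Submodule.subtype_apply, LinearMap.restrictScalars_apply]
    rw [LinearMap.pi_apply_eq_sum_univ φ]
    refine Finset.sum_congr rfl fun i _ => ?_
    congr 2
    funext j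
    simp only [Pi.single_apply, eq_comm]
  · rintro ⟨b, hb⟩
    let s : (Fin m → ℝ) →ₗ[ℤ] (Fin (m + 1) → ℝ) :=
      { toFun := fun v => Fin.snoc v (v ⬝ᵥ b)
        map_add' := fun v w => by
          ext i; refine Fin.lastCases ?_ (fun i => ?_) i <;> simp
        map_smul' := fun a v => by
          ext i
          refine Fin.lastCases ?_ (fun i => ?_) i <;>
            simp [dotProduct, Finset.mul_sum, mul_assoc] }
    have hs : Function.Injective s := fun v w h => by
      ext i
      simpa [s] using congrFun h i.castSucc
    have hmap : Submodule.span ℤ (Set.range fun d => (Fin.snoc (f d) (g d) : Fin (m + 1) → ℝ)) =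
        (Submodule.span ℤ (Set.range f)).map s := by
      rw [Submodule.map_span, ← Set.range_comp]
      congr 2
      funext d
      simp [s, hb d]
    rw [hmap, ← (Submodule.equivMapOfInjective s hs _).finrank_eq, hrank]

lemma expJ_mul_expJ_neg (t : ℝ) : expJ (-t) * expJ t = 1 := by
  have := Real.sin_sq_add_cos_sq t
  ext <;> simp only [Quaternion.re_mul, Quaternion.imI_mul, Quaternion.imJ_mul,
    Quaternion.imK_mul] <;> simp [expJ] <;> nlinarith

lemma expK_mul_expK_neg (t : ℝ) : expK t * expK (-t) = 1 := by
  have := Real.sin_sq_add_cos_sq t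
  ext <;> simp only [Quaternion.re_mul, Quaternion.imI_mul, Quaternion.imJ_mul,
    Quaternion.imK_mul] <;> simp [expK] <;> nlinarith

lemma qj_mul_expJ (t : ℝ) : qj * expJ t = expJ t * qj := by
  ext <;> simp only [Quaternion.re_mul, Quaternion.imI_mul, Quaternion.imJ_mul,
    Quaternion.imK_mul] <;> simp [expJ, qj]

lemma qk_mul_expK (t : ℝ) : qk * expK t = expK t * qk := by
  ext <;> simp only [Quaternion.re_mul, Quaternion.imI_mul, Quaternion.imJ_mul,
    Quaternion.imK_mul] <;> simp [expK, qk]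

lemma smul_qj_add_smul_qk_inj {a b c : ℝ} : a • qj + b • qk = c • qk ↔ a = 0 ∧ b = c := by
  simp only [Quaternion.ext_iff, Quaternion.re_add, Quaternion.imI_add, Quaternion.imJ_add,
    Quaternion.imK_add, Quaternion.re_smul, Quaternion.imI_smul, Quaternion.imJ_smul,
    Quaternion.imK_smul]
  simp [qj, qk]

lemma expJ_mul_mul_expK_inj {s t : ℝ} {u v : ℍ[ℝ]} :
    expJ s * u * expK t = expJ s * v * expK t ↔ u = v := by
  refine ⟨fun h => ?_, fun h => by rw [h]⟩
  have h' := congrArg (fun w => expJ (-s) * w * expK (-t)) h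
  simp only [mul_assoc, expK_mul_expK_neg, mul_one] at h'
  simpa only [← mul_assoc, expJ_mul_expJ_neg, one_mul] using h'

lemma sum_dpsi_apply (r : Fin n → ℝ) (e : Fin n → Fin l → ℝ) (f : Fin n → Fin m → ℝ)
    (x a : Fin l → ℝ) (y b : Fin m → ℝ) (d : Fin n) :
    ((∑ p, a p • dpsiX r e f x y p) + ∑ q, b q • dpsiY r e f x y q) d =
      expJ (∑ i, e d i * x i) * ((r d * (e d ⬝ᵥ a)) • qj + (r d * (f d ⬝ᵥ b)) • qk) *
        expK (∑ i, f d i * y i) := by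
  simp only [Pi.add_apply, Finset.sum_apply, Pi.smul_apply, dpsiX, dpsiY, qj_mul_expJ,
    Quaternion.coe_mul_eq_smul, smul_smul, mul_add, add_mul, mul_smul_comm, smul_mul_assoc,
    ← Finset.sum_smul, mul_assoc, dotProduct, Finset.mul_sum]
  congr 4 <;> (funext i; ring)

/-- A field `c_d ψ_d k` is tangent to the torus iff the `c_d` are the values at the `f_d` of a
linear functional. -/
lemma smul_psi_mul_qk_mem_tangentSpan_iff (r : Fin n → ℝ) (hr : ∀ d, 0 < r d)
    (e : Fin n → Fin l → ℝ) (f : Fin n → Fin m → ℝ) (c : Fin n → ℝ)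
    (x : Fin l → ℝ) (y : Fin m → ℝ) :
    (fun d => (c d • psi r e f x y d) * qk) ∈ tangentSpan r e f x y ↔
      ∃ b, ∀ d, c d = f d ⬝ᵥ b := by
  have hpsi : ∀ d, (c d • psi r e f x y d) * qk =
      expJ (∑ i, e d i * x i) * ((r d * c d) • qk) * expK (∑ i, f d i * y i) := fun d => by
    simp only [psi, Quaternion.coe_mul_eq_smul, smul_mul_assoc, mul_smul_comm, smul_smul,
      mul_assoc, qk_mul_expK, mul_comm (c d)]
  have hmem : ∀ v, v ∈ tangentSpan r e f x y ↔
      ∃ (a : Fin l → ℝ) (b : Fin m → ℝ), (∑ p, a p • dpsiX r e f x y p) + ∑ q, b q • dpsiY r e f x y q = v := fun v => by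
    rw [tangentSpan, Submodule.mem_span_range_iff_exists_fun]
    simp only [Fintype.sum_sum_type, Sum.elim_inl, Sum.elim_inr]
    exact ⟨fun ⟨w, hw⟩ => ⟨_, _, hw⟩, fun ⟨a, b, h⟩ => ⟨Sum.elim a b, by simpa using h⟩⟩
  simp only [hmem]
  simp only [funext_iff, sum_dpsi_apply, hpsi, expJ_mul_mul_expK_inj,
    smul_qj_add_smul_qk_inj, mul_eq_zero, (hr _).ne', false_or, mul_right_inj' (hr _).ne']
  exact ⟨fun ⟨_, b, h⟩ => ⟨b, fun d => (h d).2.symm⟩,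
    fun ⟨b, h⟩ => ⟨0, b, fun d => ⟨dotProduct_zero _, (h d).symm⟩⟩⟩

/-- for the torus in the unit sphere, KĤ is tangent iff
rk_ℤ⟨f''_1, …, f''_n⟩ = m, where f''_d = (f_d; α_d − (l+m)). -/
theorem stmt14 (n l m : ℕ) (hn : 1 ≤ n) (hl : 1 ≤ l) (hm : 1 ≤ m)
    (r : Fin n → ℝ) (hr : ∀ d, 0 < r d) (hsum : ∑ d, r d ^ 2 = 1)
    (e : Fin n → Fin l → ℝ) (f : Fin n → Fin m → ℝ)
    (hspanF : Submodule.span ℝ (Set.range f) = ⊤)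
    (hdisc : DiscreteTopology ↥(AddSubgroup.closure (Set.range f)))
    (hspanE : Submodule.span ℝ (Set.range e) = ⊤)
    (Hhat : (Fin l → ℝ) → (Fin m → ℝ) → Fin n → ℍ[ℝ])
    (hHhat : ∀ x y d,
      Hhat x y d = (1 - alpha r e f d / ((l : ℝ) + m)) • psi r e f x y d) :
    (∀ x y, (fun d => Hhat x y d * qk) ∈ tangentSpan r e f x y) ↔
      zrank (fun d => Fin.snoc (f d) (alpha r e f d - ((l : ℝ) + m))) = m := by
  have hlm : (l : ℝ) + m ≠ 0 := by positivity
  simp only [hHhat, smul_psi_mul_qk_mem_tangentSpan_iff r hr, forall_const]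
  refine Iff.trans ?_ (zrank_snoc_eq_iff f _ hspanF hdisc).symm
  constructor
  · rintro ⟨b, hb⟩
    refine ⟨-((l : ℝ) + m) • b, fun d => ?_⟩
    rw [dotProduct_smul, ← hb d, smul_eq_mul]
    field_simp
    ring
  · rintro ⟨b, hb⟩
    refine ⟨-((l : ℝ) + m)⁻¹ • b, fun d => ?_⟩
    rw [dotProduct_smul, ← hb d, smul_eq_mul]
    field_simp
    ring

end
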